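/- arXiv:1905.12128 — 5 statements merged into one kernel-verified Lean document; each statement's English description precedes it below -/
import Mathlib

section
/- Let a, b > 0 be real and let z ∈ ℂ with −b < Re(z) < a. Then ∫₀^∞ x^{z+b−1} (1+x)^{−(a+b)} dx = Γ(b+z)·Γ(a−z)/Γ(a+b), where the integrand uses the complex power x^{z+b−1} for x > 0. In particular, the Mellin transform of the generalized Pareto law P_{a,b} is E[P_{a,b}^z] = Γ(a−z)Γ(b+z)/(Γ(a)Γ(b)) for −b < Re(z) < a. -/
open Complex Set MeasureTheory

theorem image_div_one_add_Ioi_zero :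
    (fun x : ℝ => x / (1 + x)) '' Ioi 0 = Ioo 0 1 := by
  ext t
  simp only [mem_image, mem_Ioi, mem_Ioo]
  constructor
  · rintro ⟨x, hx, rfl⟩
    exact ⟨by positivity, by rw [div_lt_one (by positivity)]; linarith⟩
  · rintro ⟨h0, h1⟩
    have h : 0 < 1 - t := by linarith
    refine ⟨t / (1 - t), by positivity, ?_⟩
    field_simp
    ring

theorem injOn_div_one_add_Ioi_zero : InjOn (fun x : ℝ => x / (1 + x)) (Ioi 0) := by
  intro x hx y hy h
  have hx' : 0 < x := hx
  have hy' : 0 < y := hy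
  have h' := (div_eq_div_iff (by positivity) (by positivity)).1 h
  linarith

theorem hasDerivAt_div_one_add {x : ℝ} (hx : 1 + x ≠ 0) :
    HasDerivAt (fun x : ℝ => x / (1 + x)) (((1 + x) ^ 2)⁻¹) x := by
  refine ((hasDerivAt_id x).div ((hasDerivAt_id x).const_add 1) hx).congr_deriv ?_
  simp only [id]
  field_simp
  ring

/-- The beta integral as an integral over the positive half-line. -/
theorem integral_Ioi_cpow_mul_one_add_cpow (u v : ℂ) :
    ∫ x : ℝ in Ioi (0 : ℝ), (x : ℂ) ^ (u - 1) * ((1 + x : ℝ) : ℂ) ^ (-(u + v)) =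
      betaIntegral u v := by
  rw [betaIntegral, intervalIntegral.integral_of_le zero_le_one, integral_Ioc_eq_integral_Ioo,
    ← image_div_one_add_Ioi_zero, integral_image_eq_integral_abs_deriv_smul measurableSet_Ioi
      (fun x hx => (hasDerivAt_div_one_add (by
        have : 0 < x := hx
        positivity)).hasDerivWithinAt) injOn_div_one_add_Ioi_zero]
  refine setIntegral_congr_fun measurableSet_Ioi fun x hx => ?_
  have hx : 0 < x := hx
  have hy : 0 < 1 + x := by positivity
  have hyc : ((1 + x : ℝ) : ℂ) ≠ 0 := ofReal_ne_zero.2 hy.ne'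
  have h1 : (1 : ℂ) - ((x / (1 + x) : ℝ) : ℂ) = (((1 + x)⁻¹ : ℝ) : ℂ) := by
    rw [← ofReal_one, ← ofReal_sub]
    congr 1
    field_simp
    ring
  have hinv (w : ℂ) : (((1 + x)⁻¹ : ℝ) : ℂ) ^ w = ((1 + x : ℝ) : ℂ) ^ (-w) := by
    rw [ofReal_inv, inv_cpow _ _ (by
      rw [arg_ofReal_of_nonneg hy.le]; exact Real.pi_pos.ne), cpow_neg]
  have h2 : (((((1 + x) ^ 2)⁻¹ : ℝ)) : ℂ) = ((1 + x : ℝ) : ℂ) ^ (-2 : ℂ) := by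
    rw [cpow_neg, ofReal_inv, ofReal_pow]
    norm_cast
  rw [h1, abs_of_pos (by positivity), real_smul, h2, div_eq_mul_inv, ofReal_mul,
    mul_cpow_ofReal_nonneg hx.le (by positivity), hinv, hinv,
    show -(u + v) = -2 + (-(u - 1) + -(v - 1)) by ring, cpow_add _ _ hyc, cpow_add _ _ hyc]
  ring



/-- For real `a, b > 0` and `z ∈ ℂ` with `-b < Re z < a`,
`∫₀^∞ x^(z+b-1) (1+x)^(-(a+b)) dx = Γ(b+z) Γ(a-z) / Γ(a+b)`; i.e. the Mellin
transform of the generalized Pareto law `P_{a,b}` is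
`E[P_{a,b}^z] = Γ(a-z) Γ(b+z) / (Γ(a) Γ(b))`. -/
theorem generalizedPareto_mellin (a b : ℝ) (ha : 0 < a) (hb : 0 < b)
    (z : ℂ) (hz1 : -b < z.re) (hz2 : z.re < a) :
    ∫ x : ℝ in Ioi (0 : ℝ),
        (x : ℂ) ^ (z + (b : ℂ) - 1) * ((1 + x : ℝ) ^ (-(a + b)) : ℝ) =
      Complex.Gamma ((b : ℂ) + z) * Complex.Gamma ((a : ℂ) - z) /
        Complex.Gamma ((a : ℂ) + (b : ℂ)) := by
  have hu : 0 < ((b : ℂ) + z).re := by simp; linarith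
  have hv : 0 < ((a : ℂ) - z).re := by simp; linarith
  have hsum : (b : ℂ) + z + (a - z) = a + b := by ring
  have hne : Complex.Gamma ((a : ℂ) + b) ≠ 0 :=
    Gamma_ne_zero_of_re_pos (by simp; linarith)
  rw [Gamma_mul_Gamma_eq_betaIntegral hu hv, hsum, mul_div_cancel_left₀ _ hne,
    ← integral_Ioi_cpow_mul_one_add_cpow, hsum]
  refine setIntegral_congr_fun measurableSet_Ioi fun x hx => ?_
  have hx : 0 < x := hx
  rw [ofReal_cpow (by positivity), add_comm z]
  push_cast
  rfl
end

section
/- Let a, b > 0 and let X and Y be independent random variables with X distributed according to the Gamma distribution with shape b and rate 1, and Y distributed according to the Gamma distribution with shape a and rate 1. Then the law of X/Y is the generalized Pareto measure P_{a,b}; that is, the pushforward of the product measure (gammaMeasure b 1) ⊗ (gammaMeasure a 1) under the map (x,y) ↦ x/y equals the measure on ℝ with density x ↦ (Γ(a+b)/(Γ(a)Γ(b)))·x^{b−1}(1+x)^{−(a+b)} on (0,∞) with respect to Lebesgue measure. -/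
open MeasureTheory Set ProbabilityTheory

/-- The generalized Pareto measure `P_{a,b}`: the measure on `ℝ` with density
`x ↦ (Γ(a+b)/(Γ(a)Γ(b))) · x^(b-1) (1+x)^(-(a+b))` on `(0,∞)` (and `0` elsewhere)
with respect to Lebesgue measure. -/
noncomputable def generalizedParetoMeasure (a b : ℝ) : Measure ℝ :=
  volume.withDensity fun x =>
    ENNReal.ofReal
      ((Ioi (0 : ℝ)).indicator
        (fun x => Real.Gamma (a + b) / (Real.Gamma a * Real.Gamma b) *
          x ^ (b - 1) * (1 + x) ^ (-(a + b))) x)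

open scoped ENNReal in
/-- Rescaling the variable by a nonzero factor in a lower Lebesgue integral. -/
lemma lintegral_eq_ofReal_abs_mul_lintegral_comp_mul_right {f : ℝ → ℝ≥0∞} (hf : Measurable f)
    {c : ℝ} (hc : c ≠ 0) :
    ∫⁻ x, f x = ENNReal.ofReal |c| * ∫⁻ t, f (t * c) := by
  conv_lhs => rw [← Real.smul_map_volume_mul_right hc]
  rw [lintegral_smul_measure, lintegral_map hf (by fun_prop), smul_eq_mul]

@[fun_prop]
lemma measurable_gammaPDF (a r : ℝ) : Measurable (gammaPDF a r) :=
  (measurable_gammaPDFReal a r).ennreal_ofReal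

/-- The integrand of the ratio density is a multiple of the density of a gamma distribution with
shape `a + b` and rate `1 + t`. -/
lemma abs_mul_gammaPDF_mul_gammaPDF {a b t y : ℝ} (ha : 0 < a) (hb : 0 < b) (ht : 0 < t)
    (hy : y ≠ 0) :
    ENNReal.ofReal |y| * (gammaPDF a 1 y * gammaPDF b 1 (t * y)) =
      ENNReal.ofReal (Real.Gamma (a + b) / (Real.Gamma a * Real.Gamma b) *
        t ^ (b - 1) * (1 + t) ^ (-(a + b))) * gammaPDF (a + b) (1 + t) y := by
  rcases hy.lt_or_gt with hy | hy
  · simp [gammaPDF_of_neg hy]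
  have hGa := Real.Gamma_pos_of_pos ha
  have hGb := Real.Gamma_pos_of_pos hb
  have hGab := Real.Gamma_pos_of_pos (add_pos ha hb)
  have ht' : 0 < 1 + t := by positivity
  rw [gammaPDF_of_nonneg hy.le, gammaPDF_of_nonneg hy.le, gammaPDF_of_nonneg (by positivity),
    ← ENNReal.ofReal_mul (by positivity), ← ENNReal.ofReal_mul (by positivity),
    ← ENNReal.ofReal_mul (by positivity)]
  congr 1
  have hexp : Real.exp (-((1 + t) * y)) = Real.exp (-(1 * y)) * Real.exp (-(1 * (t * y))) := by
    rw [← Real.exp_add]; ring_nf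
  have hpow : y ^ (a + b - 1) = y * (y ^ (a - 1) * y ^ (b - 1)) := by
    nth_rewrite 2 [← Real.rpow_one y]
    rw [← Real.rpow_add hy, ← Real.rpow_add hy]; ring_nf
  rw [hexp, hpow, Real.mul_rpow ht.le hy.le, Real.rpow_neg ht'.le, abs_of_pos hy,
    Real.one_rpow, Real.one_rpow]
  have := (Real.rpow_pos_of_pos ht' (a + b)).ne'
  field_simp

lemma lintegral_abs_mul_gammaPDF_mul_gammaPDF {a b t : ℝ} (ha : 0 < a) (hb : 0 < b)
    (ht : t ≠ 0) :
    ∫⁻ y, ENNReal.ofReal |y| * (gammaPDF a 1 y * gammaPDF b 1 (t * y)) =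
      ENNReal.ofReal ((Ioi (0 : ℝ)).indicator
        (fun x => Real.Gamma (a + b) / (Real.Gamma a * Real.Gamma b) *
          x ^ (b - 1) * (1 + x) ^ (-(a + b))) t) := by
  rcases ht.lt_or_gt with ht | ht
  · rw [indicator_of_notMem (by simpa using ht.le), ENNReal.ofReal_zero]
    refine (lintegral_congr fun y => ?_).trans lintegral_zero
    rcases lt_trichotomy y 0 with hy | rfl | hy
    · simp [gammaPDF_of_neg hy]
    · simp
    · simp [gammaPDF_of_neg (mul_neg_of_neg_of_pos ht hy)]
  · have hae : ∀ᵐ y : ℝ, y ≠ 0 := by simp [ae_iff]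
    rw [indicator_of_mem (mem_Ioi.2 ht), lintegral_congr_ae
      (hae.mono fun y hy => abs_mul_gammaPDF_mul_gammaPDF ha hb ht hy),
      lintegral_const_mul _ (by fun_prop),
      lintegral_gammaPDF_eq_one (add_pos ha hb) (by positivity), mul_one]

/-- For `a, b > 0`, if `X ~ Gamma(b,1)` and `Y ~ Gamma(a,1)` are
independent, then `X/Y` has the generalized Pareto law `P_{a,b}`. -/
theorem gamma_ratio_is_generalizedPareto (a b : ℝ) (ha : 0 < a) (hb : 0 < b) :
    Measure.map (fun p : ℝ × ℝ => p.1 / p.2)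
        ((gammaMeasure b 1).prod (gammaMeasure a 1)) =
      generalizedParetoMeasure a b := by
  have := isProbabilityMeasure_gammaMeasure ha one_pos
  have := isProbabilityMeasure_gammaMeasure hb one_pos
  have hae : ∀ᵐ y : ℝ, y ≠ 0 := by simp [ae_iff]
  have hdiv : Measurable fun p : ℝ × ℝ => p.1 / p.2 := by fun_prop
  refine Measure.ext_of_lintegral _ fun f hf => ?_
  have hinner (y : ℝ) (hy : y ≠ 0) :
      gammaPDF a 1 y * ∫⁻ x, f (x / y) ∂gammaMeasure b 1 =
        ∫⁻ t, ENNReal.ofReal |y| * (gammaPDF a 1 y * gammaPDF b 1 (t * y)) * f t := by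
    rw [gammaMeasure, lintegral_withDensity_eq_lintegral_mul _ (by fun_prop) (by fun_prop),
      lintegral_eq_ofReal_abs_mul_lintegral_comp_mul_right (by fun_prop) hy,
      ← lintegral_const_mul _ (by fun_prop), ← lintegral_const_mul _ (by fun_prop)]
    refine lintegral_congr fun t => ?_
    simp only [Pi.mul_apply, mul_div_cancel_right₀ t hy]
    ring
  calc
    _ = ∫⁻ y, ∫⁻ x, f (x / y) ∂gammaMeasure b 1 ∂gammaMeasure a 1 := by
      rw [lintegral_map hf hdiv]
      exact lintegral_prod_symm _ (hf.comp hdiv).aemeasurable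
    _ = ∫⁻ y, gammaPDF a 1 y * ∫⁻ x, f (x / y) ∂gammaMeasure b 1 := by
      conv_lhs => rw [gammaMeasure.eq_def a 1]
      exact lintegral_withDensity_eq_lintegral_mul _ (by fun_prop)
        (hf.comp hdiv).lintegral_prod_left'
    _ = ∫⁻ y, ∫⁻ t, ENNReal.ofReal |y| * (gammaPDF a 1 y * gammaPDF b 1 (t * y)) * f t :=
      lintegral_congr_ae (hae.mono hinner)
    _ = ∫⁻ t, ∫⁻ y, ENNReal.ofReal |y| * (gammaPDF a 1 y * gammaPDF b 1 (t * y)) * f t :=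
      lintegral_lintegral_swap (by fun_prop)
    _ = ∫⁻ t, ENNReal.ofReal ((Ioi (0 : ℝ)).indicator
        (fun x => Real.Gamma (a + b) / (Real.Gamma a * Real.Gamma b) *
          x ^ (b - 1) * (1 + x) ^ (-(a + b))) t) * f t := by
      refine lintegral_congr_ae (hae.mono fun t ht => ?_)
      dsimp only
      rw [lintegral_mul_const _ (by fun_prop), lintegral_abs_mul_gammaPDF_mul_gammaPDF ha hb ht]
    _ = _ := by
      refine (lintegral_withDensity_eq_lintegral_mul _ ?_ hf).symm
      exact (Measurable.indicator (by fun_prop) measurableSet_Ioi).ennreal_ofReal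
end

section
/- Let α ∈ (0,2), ρ ∈ (0,1), and let z ∈ ℂ with z ≠ 0, z ≠ −1, αz ∉ ℤ and α(z + 1 − ρ) ∉ ℤ. Then (z/(z+1))·Ψ_{α,ρ}(z+1) = −Γ(α + αz)·Γ(1 − αz) / (Γ(α(1−ρ) + αz)·Γ(1 − α(1−ρ) − αz)), where Ψ_{α,ρ}(z) = −Γ(1 + αz)·Γ(α − αz)/(Γ(1 − αρ + αz)·Γ(αρ − αz)). -/
/-- The Lamperti-stable characteristic exponent
`Ψ_{α,ρ}(z) = -Γ(1 + αz) Γ(α - αz) / (Γ(1 - αρ + αz) Γ(αρ - αz))`. -/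
noncomputable def lampertiStableExponent (α ρ : ℝ) (z : ℂ) : ℂ :=
  -(Complex.Gamma (1 + α * z) * Complex.Gamma (α - α * z)) /
    (Complex.Gamma (1 - α * ρ + α * z) * Complex.Gamma (α * ρ - α * z))

/-- For `α ∈ (0,2)`, `ρ ∈ (0,1)` and `z ∈ ℂ` with `z ≠ 0`,
`z ≠ -1`, `αz ∉ ℤ`, `α(z + 1 - ρ) ∉ ℤ`, one has
`(z/(z+1)) Ψ_{α,ρ}(z+1)
  = -Γ(α + αz) Γ(1 - αz) / (Γ(α(1-ρ) + αz) Γ(1 - α(1-ρ) - αz))`. -/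
theorem lampertiStable_T1 (α ρ : ℝ) (hα0 : 0 < α) (hα2 : α < 2)
    (hρ0 : 0 < ρ) (hρ1 : ρ < 1) (z : ℂ) (hz0 : z ≠ 0) (hz1 : z ≠ -1)
    (h1 : ∀ n : ℤ, (α : ℂ) * z ≠ (n : ℂ))
    (h2 : ∀ n : ℤ, (α : ℂ) * (z + 1 - ρ) ≠ (n : ℂ)) :
    z / (z + 1) * lampertiStableExponent α ρ (z + 1) =
      -(Complex.Gamma (α + α * z) * Complex.Gamma (1 - α * z)) /
        (Complex.Gamma (α * (1 - ρ) + α * z) *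
          Complex.Gamma (1 - α * (1 - ρ) - α * z)) := by
  have hz1' : z + 1 ≠ 0 := fun h => hz1 (eq_neg_of_add_eq_zero_left h)
  have hα : (α : ℂ) ≠ 0 := by exact_mod_cast hα0.ne'
  have hc : (α : ℂ) * (z + 1 - ρ) ≠ 0 := by simpa using h2 0
  have gα : Complex.Gamma (1 + α * (z + 1)) =
      α * (z + 1) * Complex.Gamma (α + α * z) := by
    rw [add_comm, Complex.Gamma_add_one _ (mul_ne_zero hα hz1')]
    ring_nf
  have gz : Complex.Gamma (1 - α * z) =
      -(α * z) * Complex.Gamma (α - α * (z + 1)) := by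
    rw [sub_eq_neg_add, Complex.Gamma_add_one _ (neg_ne_zero.mpr (mul_ne_zero hα hz0))]
    ring_nf
  have gc : Complex.Gamma (1 - α * ρ + α * (z + 1)) =
      α * (z + 1 - ρ) * Complex.Gamma (α * (1 - ρ) + α * z) := by
    rw [show (1 : ℂ) - α * ρ + α * (z + 1) = α * (z + 1 - ρ) + 1 by ring,
      Complex.Gamma_add_one _ hc]
    ring_nf
  have gc' : Complex.Gamma (1 - α * (1 - ρ) - α * z) =
      -(α * (z + 1 - ρ)) * Complex.Gamma (α * ρ - α * (z + 1)) := by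
    rw [show (1 : ℂ) - α * (1 - ρ) - α * z = -(α * (z + 1 - ρ)) + 1 by ring,
      Complex.Gamma_add_one _ (neg_ne_zero.mpr hc)]
    ring_nf
  have hden : α * (z + 1 - ρ) * Complex.Gamma (α * (1 - ρ) + α * z) *
        Complex.Gamma (α * ρ - α * (z + 1)) =
      -(Complex.Gamma (α * (1 - ρ) + α * z) *
        Complex.Gamma (1 - α * (1 - ρ) - α * z)) := by
    rw [gc']
    ring
  rw [lampertiStableExponent]
  rw [gα, gc, hden, gz, neg_div_neg_eq, ← mul_div_assoc]
  congr 1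
  field_simp
end

section
/- Let α ∈ (0,2), ρ ∈ (0,1), and let z ∈ ℂ with z ≠ 0, z ≠ 1, αz ∉ ℤ and α(z − 1 + ρ) ∉ ℤ. Then (−z/(1 − z))·Ψ_{α,ρ}(1 − z) = Ψ_{α,1−ρ}(z); that is, the transformation T₁ applied to the Lamperti-stable exponent with parameters (α, ρ) followed by duality (z ↦ −z) yields the Lamperti-stable exponent with parameters (α, 1−ρ). -/
/-- For `α ∈ (0,2)`, `ρ ∈ (0,1)` and `z ∈ ℂ` with `z ≠ 0`,
`z ≠ 1`, `αz ∉ ℤ`, `α(z - 1 + ρ) ∉ ℤ`, one has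
`(-z/(1-z)) Ψ_{α,ρ}(1-z) = Ψ_{α,1-ρ}(z)`: the transformation `T₁` applied to
the Lamperti-stable exponent with parameters `(α,ρ)` followed by duality
`z ↦ -z` yields the Lamperti-stable exponent with parameters `(α, 1-ρ)`. -/
theorem lampertiStable_T1_dual (α ρ : ℝ) (hα0 : 0 < α) (hα2 : α < 2)
    (hρ0 : 0 < ρ) (hρ1 : ρ < 1) (z : ℂ) (hz0 : z ≠ 0) (hz1 : z ≠ 1)
    (h1 : ∀ n : ℤ, (α : ℂ) * z ≠ (n : ℂ))
    (h2 : ∀ n : ℤ, (α : ℂ) * (z - 1 + ρ) ≠ (n : ℂ)) :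
    -z / (1 - z) * lampertiStableExponent α ρ (1 - z) =
      lampertiStableExponent α (1 - ρ) z := by
  have hα : (α : ℂ) ≠ 0 := by exact_mod_cast hα0.ne'
  have hz : 1 - z ≠ 0 := sub_ne_zero.mpr hz1.symm
  have hw : (α : ℂ) * (z - 1 + ρ) ≠ 0 := by simpa using h2 0
  unfold lampertiStableExponent
  set w : ℂ := α * (z - 1 + ρ) with hwdef
  have e1 : (1 : ℂ) + α * (1 - z) = α * (1 - z) + 1 := by ring
  have e2 : (α : ℂ) - α * (1 - z) = α * z := by ring
  have e3 : (1 : ℂ) - α * ρ + α * (1 - z) = -w + 1 := by rw [hwdef]; ring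
  have e4 : (α : ℂ) * ρ - α * (1 - z) = w := by rw [hwdef]; ring
  have e5 : (1 : ℂ) + α * z = α * z + 1 := by ring
  have e6 : (α : ℂ) - α * z = α * (1 - z) := by ring
  have e7 : (1 : ℂ) - α * (1 - ρ : ℝ) + α * z = w + 1 := by rw [hwdef]; push_cast; ring
  have e8 : (α : ℂ) * (1 - ρ : ℝ) - α * z = -w := by rw [hwdef]; push_cast; ring
  rw [e1, e2, e3, e4, e5, e6, e7, e8, Complex.Gamma_add_one _ (mul_ne_zero hα hz),
    Complex.Gamma_add_one _ (mul_ne_zero hα hz0), Complex.Gamma_add_one _ hw,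
    Complex.Gamma_add_one _ (neg_ne_zero.mpr hw)]
  clear_value w
  field_simp
end

section
/- Let α ∈ (0,2) and ρ ∈ (0,1) with α(1 − ρ) < 1. Then (u/(u+1))·Ψ_{α,ρ}(u+1) tends to −Γ(α)/(Γ(α(1−ρ))·Γ(1 − α(1−ρ))) as the real number u tends to 0 from the right, and this limit is strictly negative. -/
open Filter Topology

/-- The Lamperti-stable characteristic exponent (real argument):
`Ψ_{α,ρ}(u) = -Γ(1 + αu) Γ(α - αu) / (Γ(1 - αρ + αu) Γ(αρ - αu))`. -/
noncomputable def lampertiStableExponentReal (α ρ : ℝ) (u : ℝ) : ℝ :=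
  -(Real.Gamma (1 + α * u) * Real.Gamma (α - α * u)) /
    (Real.Gamma (1 - α * ρ + α * u) * Real.Gamma (α * ρ - α * u))

/-- For `α ∈ (0,2)`, `ρ ∈ (0,1)` with `α(1-ρ) < 1`,
`(u/(u+1)) Ψ_{α,ρ}(u+1) → -Γ(α)/(Γ(α(1-ρ)) Γ(1 - α(1-ρ)))` as `u → 0⁺`, and
this limit is strictly negative. -/
theorem lampertiStable_limit_at_zero (α ρ : ℝ) (hα0 : 0 < α) (hα2 : α < 2)
    (hρ0 : 0 < ρ) (hρ1 : ρ < 1) (h : α * (1 - ρ) < 1) :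
    Tendsto (fun u : ℝ => u / (u + 1) * lampertiStableExponentReal α ρ (u + 1))
        (𝓝[>] (0 : ℝ))
        (𝓝 (-Real.Gamma α /
          (Real.Gamma (α * (1 - ρ)) * Real.Gamma (1 - α * (1 - ρ))))) ∧
      -Real.Gamma α /
          (Real.Gamma (α * (1 - ρ)) * Real.Gamma (1 - α * (1 - ρ))) < 0 := by
  have hb0 : 0 < α * (1 - ρ) := mul_pos hα0 (sub_pos.2 hρ1)
  set b := α * (1 - ρ) with hb
  have hΓα := Real.Gamma_pos_of_pos hα0
  have hΓb := Real.Gamma_pos_of_pos hb0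
  have hΓb' := Real.Gamma_pos_of_pos (sub_pos.2 h)
  refine ⟨?_, div_neg_of_neg_of_pos (neg_neg_of_pos hΓα) (mul_pos hΓb hΓb')⟩
  have hΓ_neg : Real.Gamma (1 - b) = -b * Real.Gamma (-b) := by
    rw [← Real.Gamma_add_one (neg_ne_zero.2 hb0.ne'), neg_add_eq_sub]
  have hΓ_succ : Real.Gamma (1 + b) = b * Real.Gamma b := by
    rw [add_comm, Real.Gamma_add_one hb0.ne']
  have hΓ_neg_ne : Real.Gamma (-b) ≠ 0 := by
    rintro h0
    rw [h0, mul_zero] at hΓ_neg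
    exact hΓb'.ne' hΓ_neg
  have neg_b_not_pole : ∀ m : ℕ, -b ≠ -m := by
    intro m hm
    exact hΓ_neg_ne (hm ▸ Real.Gamma_neg_nat_eq_zero m)
  have hcont_pos {c : ℝ} (hc : 0 < c) : ContinuousAt Real.Gamma c :=
    (Real.differentiableOn_Gamma_Ioi.differentiableAt (Ioi_mem_nhds hc)).continuousAt
  have lim_affine (F : ℝ → ℝ) (c d : ℝ) (hF : ContinuousAt F c) :
      Tendsto (fun u => F (c + d * u)) (𝓝[>] 0) (𝓝 (F c)) := by
    have h1 : Tendsto (fun u : ℝ => c + d * u) (𝓝[>] 0) (𝓝 c) := by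
      have h2 : Continuous fun u : ℝ => c + d * u := by fun_prop
      simpa using (h2.tendsto 0).mono_left nhdsWithin_le_nhds
    exact hF.tendsto.comp h1
  have h1 := lim_affine Real.Gamma (1 + α) α (hcont_pos (by linarith))
  have h2 := lim_affine Real.Gamma 1 (-α) (hcont_pos one_pos)
  have h3 := lim_affine Real.Gamma (1 + b) α (hcont_pos (by linarith))
  have h4 := lim_affine Real.Gamma (-b) (-α)
    (Real.differentiableAt_Gamma neg_b_not_pole).continuousAt
  have h5 := lim_affine id α α continuousAt_id
  have hden : Real.Gamma (1 + b) * Real.Gamma (-b) ≠ 0 := by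
    rw [hΓ_succ]
    positivity
  have hlim := ((h1.mul h2).div h5 hα0.ne').div (h3.mul h4) hden
  have hval : Real.Gamma (1 + α) * Real.Gamma 1 / id α / (Real.Gamma (1 + b) * Real.Gamma (-b)) =
      -Real.Gamma α / (Real.Gamma b * Real.Gamma (1 - b)) := by
    rw [hΓ_neg, hΓ_succ, add_comm 1 α, Real.Gamma_add_one hα0.ne', Real.Gamma_one, id]
    field_simp
  rw [hval] at hlim
  refine hlim.congr' ?_
  filter_upwards [self_mem_nhdsWithin] with u hu
  have hu0 : 0 < u := hu
  have hαu : -α * u ≠ 0 := mul_ne_zero (neg_ne_zero.2 hα0.ne') hu0.ne'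
  have hΓu : Real.Gamma (1 + -α * u) = -α * u * Real.Gamma (-α * u) := by
    rw [add_comm, Real.Gamma_add_one hαu]
  have e1 : 1 + α * (u + 1) = 1 + α + α * u := by ring
  have e2 : α - α * (u + 1) = -α * u := by ring
  have e3 : 1 - α * ρ + α * (u + 1) = 1 + b + α * u := by rw [hb]; ring
  have e4 : α * ρ - α * (u + 1) = -b + -α * u := by rw [hb]; ring
  have e5 : α + α * u = α * (u + 1) := by ring
  simp only [Pi.div_apply, lampertiStableExponentReal, e1, e2, e3, e4, id, hΓu, e5]
  have hu1 : u + 1 ≠ 0 := by positivity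
  rw [← mul_div_assoc]
  congr 1
  field_simp
end
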